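/- For every ε, δ ∈ (0,1) the following holds. For each integer h with ⌈δh⌉ ≥ 2, set d := ⌈δ·h⌉ and let N := N(h) be the largest integer satisfying h·log(√d) ≥ d·log(N/d) (natural logarithms), equivalently N = ⌊d^{1+h/(2d)}⌋. Then the probability, under the uniform distribution on h×N sign matrices R ∈ {−1,1}^{h×N}, that no nonzero vector u ∈ ℝ^N with ‖u‖₀ ≤ (1−ε)·d satisfies Ru = 0, tends to 1 as h → ∞. -/

import Mathlib

open Matrix

noncomputable section

/-- Hamming weight of a vector: number of nonzero coordinates. -/
def hw {n : ℕ} (x : Fin n → ℝ) : ℕ :=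
  (Function.support x).ncard

/-- Probability of the event `P` under the uniform distribution on a finite type. -/
def prob {α : Type*} [Fintype α] (P : α → Prop) : ℝ :=
  ({a | P a} : Set α).ncard / Fintype.card α

/-- The `±1` sign matrix encoded by a Boolean matrix. -/
def signMat {h N : ℕ} (s : Fin h → Fin N → Bool) : Matrix (Fin h) (Fin N) ℝ :=
  fun i j => if s i j then 1 else -1

/-- `d = ⌈δ·h⌉`. -/
def dOf (δ : ℝ) (h : ℕ) : ℕ := ⌈δ * h⌉₊

/-- The largest `N` with `h·log √d ≥ d·log(N/d)`, i.e. `N = ⌊d^{1+h/(2d)}⌋`. -/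
def NOf (δ : ℝ) (h : ℕ) : ℕ :=
  ⌊(dOf δ h : ℝ) ^ ((1 : ℝ) + (h : ℝ) / (2 * (dOf δ h : ℝ)))⌋₊

/-- The sign `1` or `-1` encoded by a Boolean. -/
def boolSign (R : Type*) [Ring R] (b : Bool) : R := if b then 1 else -1

/-- Number of sign vectors orthogonal to `u`. -/
def orthCount {ι R : Type*} [Fintype ι] [Ring R] (u : ι → R) : ℕ :=
  {r : ι → Bool | ∑ j, boolSign R (r j) * u j = 0}.ncard

/-- Euclidean distance from `(ψ (t * u j))_j` to the all-ones vector, where `ψ` is the standard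
additive character of `ZMod p`. -/
def charDist {ι : Type*} [Fintype ι] {p : ℕ} [NeZero p] (u : ι → ZMod p) (t : ZMod p) : ℝ :=
  ‖WithLp.toLp 2 (fun j => (ZMod.stdAddChar (t * u j) - 1 : ℂ))‖

/-- The set of `t` with `charDist u t ≤ r`. -/
def charBall {ι : Type*} [Fintype ι] {p : ℕ} [NeZero p] (u : ι → ZMod p) (r : ℝ) :
    Finset (ZMod p) := by
  classical exact Finset.univ.filter (fun t => charDist u t ≤ r)

section Reduction

/-- If an integer matrix has a left inverse modulo `p`, then it is injective over `ℝ`. -/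
theorem injective_of_injective_mod {m n : Type*} [Fintype m] [Fintype n] [DecidableEq n]
    [DecidableEq m] {p : ℕ} [Fact p.Prime] (B : Matrix m n ℤ)
    (hB : ∀ v : n → ZMod p, (B.map (Int.castRingHom (ZMod p))).mulVec v = 0 → v = 0)
    (v : n → ℝ) (hv : (B.map (Int.castRingHom ℝ)).mulVec v = 0) : v = 0 := by
  obtain ⟨g, hg⟩ := LinearMap.exists_leftInverse_of_injective
    (Matrix.toLin' (B.map (Int.castRingHom (ZMod p))))
    (LinearMap.ker_eq_bot'.2 fun v hv => hB v (by simpa using hv))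
  have hC : LinearMap.toMatrix' g * B.map (Int.castRingHom (ZMod p)) = 1 := by
    have := congrArg LinearMap.toMatrix' hg
    rwa [LinearMap.toMatrix'_comp, LinearMap.toMatrix'_toLin', LinearMap.toMatrix'_id] at this
  obtain ⟨C, hCC⟩ : ∃ C : Matrix n m ℤ,
      C.map (Int.castRingHom (ZMod p)) = LinearMap.toMatrix' g := by
    choose f hf using ZMod.intCast_surjective (n := p)
    refine ⟨Matrix.of fun i j => f (LinearMap.toMatrix' g i j), ?_⟩
    ext i j
    rw [Matrix.map_apply, Matrix.of_apply, eq_intCast, hf]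
  have hdet : (C * B).det ≠ 0 := by
    intro h0
    have h1 : ((C * B).map (Int.castRingHom (ZMod p))).det = 1 := by
      rw [Matrix.map_mul, hCC, hC, Matrix.det_one]
    have h2 := RingHom.map_det (Int.castRingHom (ZMod p)) (C * B)
    rw [RingHom.mapMatrix_apply, h1, h0, map_zero] at h2
    exact zero_ne_one h2
  have hdetR : ((C * B).map (Int.castRingHom ℝ)).det ≠ 0 := by
    have h2 := RingHom.map_det (Int.castRingHom ℝ) (C * B)
    rw [RingHom.mapMatrix_apply] at h2
    rw [← h2]
    simpa using hdet
  refine Matrix.eq_zero_of_mulVec_eq_zero hdetR ?_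
  rw [Matrix.map_mul, ← Matrix.mulVec_mulVec, hv, Matrix.mulVec_zero]

/-- A sparse real kernel vector of a sign matrix yields a sparse kernel vector modulo `p`. -/
theorem exists_mod_kernel {h N : ℕ} (p : ℕ) [Fact p.Prime] (s : Fin h → Fin N → Bool)
    (u : Fin N → ℝ) (hu : u ≠ 0) (hsu : (signMat s).mulVec u = 0) :
    ∃ v : Fin N → ZMod p, v ≠ 0 ∧ (Finset.univ.filter (fun j => v j ≠ 0)).card ≤ hw u ∧
      ∀ i, ∑ j, boolSign (ZMod p) (s i j) * v j = 0 := by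
  classical
  set S := Finset.univ.filter (fun j => u j ≠ 0) with hS
  have hcard : hw u = S.card := by
    unfold hw
    rw [← Set.ncard_coe_finset]
    congr 1
    ext j
    simp [hS]
  let B : Matrix (Fin h) S ℤ := fun i j => boolSign ℤ (s i j)
  by_contra hcon
  push Not at hcon
  apply hu
  have key := injective_of_injective_mod (p := p) B ?_ (fun j : S => u j) ?_
  · ext j
    by_cases hj : j ∈ S
    · exact congrFun key ⟨j, hj⟩
    · simpa [hS] using hj
  · intro v hv
    by_contra hv0
    let w : Fin N → ZMod p := fun j => if hj : j ∈ S then v ⟨j, hj⟩ else 0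
    have hw0 : ∀ j : S, w j = v j := fun j => by simp [w]
    obtain ⟨i, hi⟩ := hcon w
      (fun h0 => hv0 (by ext j; rw [← hw0, h0]; rfl))
      (by
        rw [hcard]
        refine Finset.card_le_card fun j hj => ?_
        by_contra hjS
        simp [w, hjS] at hj)
    apply hi
    have hvi := congrFun hv i
    simp only [Matrix.mulVec, dotProduct, Matrix.map_apply, Pi.zero_apply] at hvi
    rw [← hvi, ← Finset.sum_subset (Finset.subset_univ S), ← Finset.sum_coe_sort S]
    · refine Finset.sum_congr rfl fun j _ => ?_
      rw [hw0]
      simp only [B, boolSign]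
      split_ifs <;> simp
    · intro j _ hj
      simp [w, hj]
  · ext i
    have hvi := congrFun hsu i
    simp only [Matrix.mulVec, dotProduct, Pi.zero_apply] at hvi
    simp only [Matrix.mulVec, dotProduct, Matrix.map_apply, Pi.zero_apply]
    rw [← hvi, ← Finset.sum_subset (Finset.subset_univ S), ← Finset.sum_coe_sort S]
    · refine Finset.sum_congr rfl fun j _ => ?_
      simp only [B, boolSign, signMat]
      split_ifs <;> simp
    · intro j _ hj
      have : u j = 0 := by simpa [hS] using hj
      simp [this]

theorem ncard_forall_rows {h N : ℕ} {R : Type*} [Ring R] (v : Fin N → R) :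
    {s : Fin h → Fin N → Bool | ∀ i, ∑ j, boolSign R (s i j) * v j = 0}.ncard =
      orthCount v ^ h := by
  classical
  unfold orthCount
  rw [Set.ncard_eq_toFinset_card', Set.ncard_eq_toFinset_card', Set.toFinset_ofPred,
    Set.toFinset_ofPred]
  rw [show (Finset.univ.filter
      fun s : Fin h → Fin N → Bool => ∀ i, ∑ j, boolSign R (s i j) * v j = 0) =
    Fintype.piFinset (fun _ : Fin h => Finset.univ.filter
      fun r : Fin N → Bool => ∑ j, boolSign R (r j) * v j = 0) by ext; simp]
  simp

end Reduction

section Halasz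

variable {ι : Type*} [Fintype ι] {p : ℕ} [Fact p.Prime]

theorem addChar_sum_eq_prod {A R : Type*} [AddCommMonoid A] [CommMonoid R] (ψ : AddChar A R)
    (f : ι → A) : ψ (∑ j, f j) = ∏ j, ψ (f j) := by
  classical
  induction (Finset.univ : Finset ι) using Finset.induction_on with
  | empty => simp
  | insert a s ha ih => rw [Finset.sum_insert ha, Finset.prod_insert ha, AddChar.map_add_eq_mul, ih]

theorem charDist_sq (u : ι → ZMod p) (t : ZMod p) :
    charDist u t ^ 2 = ∑ j, ‖(ZMod.stdAddChar (t * u j) - 1 : ℂ)‖ ^ 2 := by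
  unfold charDist
  rw [EuclideanSpace.norm_sq_eq]

theorem charDist_nonneg (u : ι → ZMod p) (t : ZMod p) : 0 ≤ charDist u t := norm_nonneg _

theorem charDist_zero (u : ι → ZMod p) : charDist u 0 = 0 := by
  have h : charDist u 0 ^ 2 = 0 := by rw [charDist_sq]; simp
  exact pow_eq_zero_iff (two_ne_zero) |>.1 h

theorem charDist_add_le (u : ι → ZMod p) (s t : ZMod p) :
    charDist u (s + t) ≤ charDist u s + charDist u t := by
  set w : EuclideanSpace ℂ ι := WithLp.toLp 2 (fun j =>
    (ZMod.stdAddChar (s * u j) : ℂ) * (ZMod.stdAddChar (t * u j) - 1)) with hw'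
  have hnorm : ‖w‖ = charDist u t := by
    rw [← sq_eq_sq₀ (norm_nonneg _) (charDist_nonneg _ _), charDist_sq, EuclideanSpace.norm_sq_eq]
    refine Finset.sum_congr rfl fun j _ => ?_
    simp [hw']
  rw [← hnorm, add_comm]
  unfold charDist
  refine le_trans (le_of_eq ?_) (norm_add_le _ _)
  congr 1
  ext j
  simp [hw', add_mul, AddChar.map_add_eq_mul]
  ring

theorem mem_charBall {u : ι → ZMod p} {r : ℝ} {t : ZMod p} :
    t ∈ charBall u r ↔ charDist u t ≤ r := by
  simp [charBall]

theorem zero_mem_charBall (u : ι → ZMod p) {r : ℝ} (hr : 0 ≤ r) : 0 ∈ charBall u r := by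
  rw [mem_charBall, charDist_zero]
  exact hr

open scoped Pointwise in
/-- Growth of the balls `charBall u r` by iterating the Cauchy–Davenport theorem. -/
theorem min_le_card_charBall (u : ι → ZMod p) {r : ℝ} (hr : 0 ≤ r) (q : ℕ) :
    min p (q * ((charBall u r).card - 1) + 1) ≤ (charBall u (q * r)).card := by
  induction q with
  | zero =>
    refine (min_le_right _ _).trans ?_
    simp only [zero_mul, zero_add, Nat.one_le_iff_ne_zero, ← Nat.pos_iff_ne_zero,
      Finset.card_pos]
    exact ⟨0, zero_mem_charBall u (by simp)⟩
  | succ q ih =>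
    have hne : (charBall u r).Nonempty := ⟨0, zero_mem_charBall u hr⟩
    have hne' : (charBall u (q * r)).Nonempty := ⟨0, zero_mem_charBall u (by positivity)⟩
    have hsub : charBall u (q * r) + charBall u r ⊆ charBall u ((q + 1 : ℕ) * r) := by
      intro x hx
      obtain ⟨a, ha, b, hb, rfl⟩ := Finset.mem_add.1 hx
      rw [mem_charBall] at ha hb ⊢
      refine (charDist_add_le u a b).trans ?_
      push_cast
      linarith
    have h1 := ZMod.cauchy_davenport Fact.out hne' hne
    have h2 := Finset.card_le_card hsub
    have h3 := hne.card_pos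
    have h4 : (q + 1) * ((charBall u r).card - 1) =
      q * ((charBall u r).card - 1) + ((charBall u r).card - 1) := by ring
    rw [h4]
    omega

theorem sum_charDist_sq (u : ι → ZMod p) :
    ∑ t, charDist u t ^ 2 = 2 * p * (Finset.univ.filter (fun j => u j ≠ 0)).card := by
  classical
  have hone : ∀ x : ZMod p, ‖(ZMod.stdAddChar x - 1 : ℂ)‖ ^ 2 =
      2 - 2 * (ZMod.stdAddChar x : ℂ).re := by
    intro x
    have h1 : ‖(ZMod.stdAddChar x : ℂ)‖ ^ 2 = 1 := by simp
    rw [← Complex.normSq_eq_norm_sq, Complex.normSq_apply] at h1 ⊢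
    simp
    linarith
  simp_rw [charDist_sq]
  rw [Finset.sum_comm, Finset.card_filter]
  push_cast
  rw [Finset.mul_sum]
  refine Finset.sum_congr rfl fun j _ => ?_
  simp_rw [hone]
  rw [Finset.sum_sub_distrib, ← Finset.mul_sum, ← Complex.re_sum,
    AddChar.sum_mulShift _ (ZMod.isPrimitive_stdAddChar p)]
  split_ifs with h0 h1 <;> simp_all [ZMod.card, mul_comm]

theorem norm_stdAddChar_add_neg_le (x : ZMod p) :
    ‖(ZMod.stdAddChar x + ZMod.stdAddChar (-x) : ℂ)‖ ≤
      2 * Real.exp (-(‖(ZMod.stdAddChar (2 * x) - 1 : ℂ)‖ ^ 2 / 8)) := by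
  set z : ℂ := ZMod.stdAddChar (2 * x) with hz
  have hz1 : ‖z‖ = 1 := by simp [hz]
  have h1 : ‖(ZMod.stdAddChar x + ZMod.stdAddChar (-x) : ℂ)‖ = ‖z + 1‖ := by
    have : (ZMod.stdAddChar x + ZMod.stdAddChar (-x) : ℂ) = ZMod.stdAddChar (-x) * (z + 1) := by
      rw [mul_add, hz, ← AddChar.map_add_eq_mul, mul_one]
      ring_nf
    rw [this, norm_mul, AddChar.norm_apply, one_mul]
  have h2 : ‖z + 1‖ ^ 2 = 4 * (1 - ‖z - 1‖ ^ 2 / 4) := by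
    have := parallelogram_law_with_norm ℝ z 1
    simp only [hz1, norm_one] at this
    linarith
  rw [h1]
  refine le_of_sq_le_sq ?_ (by positivity)
  rw [h2, mul_pow, ← Real.exp_nat_mul]
  have := Real.add_one_le_exp (-(‖z - 1‖ ^ 2 / 4))
  have h3 : (2 : ℕ) * (-(‖z - 1‖ ^ 2 / 8)) = -(‖z - 1‖ ^ 2 / 4) := by push_cast; ring
  rw [h3]
  linarith

/-- Fourier-analytic bound for the number of sign vectors orthogonal to `u`. -/
theorem mul_orthCount_le (hp : p ≠ 2) (u : ι → ZMod p) :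
    (p : ℝ) * orthCount u ≤ 2 ^ Fintype.card ι * ∑ t, Real.exp (-(charDist u t ^ 2 / 8)) := by
  classical
  have h2 : (2 : ZMod p) ≠ 0 := by
    intro h
    have : ((2 : ℕ) : ZMod p) = 0 := by exact_mod_cast h
    rw [ZMod.natCast_eq_zero_iff] at this
    exact hp ((Nat.prime_dvd_prime_iff_eq Fact.out Nat.prime_two).1 this)
  have hF : ((p : ℂ) * orthCount u) =
      ∑ t : ZMod p, ∏ j, (ZMod.stdAddChar (t * u j) + ZMod.stdAddChar (-(t * u j)) : ℂ) := by
    have hprod : ∀ t : ZMod p,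
        ∏ j, (ZMod.stdAddChar (t * u j) + ZMod.stdAddChar (-(t * u j)) : ℂ) =
        ∑ r : ι → Bool, (ZMod.stdAddChar (t * ∑ j, boolSign (ZMod p) (r j) * u j) : ℂ) := by
      intro t
      have : ∀ j, (ZMod.stdAddChar (t * u j) + ZMod.stdAddChar (-(t * u j)) : ℂ) =
          ∑ b : Bool, ZMod.stdAddChar (t * (boolSign (ZMod p) b * u j)) := by
        intro j
        simp [boolSign]
      simp_rw [this]
      rw [Fintype.prod_sum]
      refine Finset.sum_congr rfl fun r _ => ?_
      rw [Finset.mul_sum, addChar_sum_eq_prod]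
    simp_rw [hprod]
    rw [Finset.sum_comm]
    simp_rw [AddChar.sum_mulShift _ (ZMod.isPrimitive_stdAddChar p)]
    push_cast
    rw [← Finset.sum_filter, Finset.sum_const, ZMod.card, nsmul_eq_mul, mul_comm]
    unfold orthCount
    rw [Set.ncard_eq_toFinset_card', Set.toFinset_ofPred]
  have hN : (p : ℝ) * orthCount u = ‖((p : ℂ) * orthCount u)‖ := by simp
  rw [hN, hF]
  calc _ ≤ ∑ t : ZMod p, ∏ j, ‖(ZMod.stdAddChar (t * u j) + ZMod.stdAddChar (-(t * u j)) : ℂ)‖ := by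
        refine (norm_sum_le _ _).trans (le_of_eq ?_)
        simp_rw [norm_prod]
    _ ≤ ∑ t : ZMod p, 2 ^ Fintype.card ι * Real.exp (-(charDist u (2 * t) ^ 2 / 8)) := by
        refine Finset.sum_le_sum fun t _ => ?_
        refine (Finset.prod_le_prod (fun _ _ => norm_nonneg _)
          fun j _ => norm_stdAddChar_add_neg_le (t * u j)).trans (le_of_eq ?_)
        rw [Finset.prod_mul_distrib, Finset.prod_const, ← Real.exp_sum, charDist_sq,
          Finset.sum_neg_distrib, Finset.sum_div]
        simp_rw [mul_assoc]
        rfl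
    _ = _ := by
        rw [← Finset.mul_sum]
        congr 1
        exact Fintype.sum_equiv (Equiv.mulLeft₀ 2 h2) _ _ fun t => rfl

/-- Halász-type bound: the concentration of `u` is controlled by the size of a large ball. -/
theorem mul_orthCount_le_card_charBall (hp : p ≠ 2) (u : ι → ZMod p) {q : ℕ} (hq : 0 < q)
    {r : ℝ} (hr : 0 ≤ r) (hr8 : 8 * Real.log p ≤ r ^ 2)
    (hball : (q * r) ^ 2 < 2 * (Finset.univ.filter (fun j => u j ≠ 0)).card) :
    (p : ℝ) * orthCount u ≤
      2 ^ Fintype.card ι * (2 + (charBall u (q * r)).card / q) := by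
  classical
  have hp0 : (0 : ℝ) < p := by exact_mod_cast (Fact.out : p.Prime).pos
  refine (mul_orthCount_le hp u).trans (mul_le_mul_of_nonneg_left ?_ (by positivity))
  have hlt : (charBall u (q * r)).card < p := by
    by_contra hge
    have huniv : charBall u (q * r) = Finset.univ := by
      rw [← Finset.card_eq_iff_eq_univ, ZMod.card]
      exact le_antisymm ((Finset.card_le_univ _).trans_eq (ZMod.card p)) (not_lt.1 hge)
    have hsum : ∑ t, charDist u t ^ 2 ≤ ∑ _t : ZMod p, (q * r) ^ 2 := by
      refine Finset.sum_le_sum fun t _ => ?_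
      have ht : t ∈ charBall u (q * r) := huniv ▸ Finset.mem_univ t
      rw [mem_charBall] at ht
      exact pow_le_pow_left₀ (charDist_nonneg u t) ht 2
    rw [sum_charDist_sq, Finset.sum_const, Finset.card_univ, ZMod.card, nsmul_eq_mul] at hsum
    nlinarith
  have hcd := min_le_card_charBall u hr q
  have hcd' : q * ((charBall u r).card - 1) + 1 ≤ (charBall u (q * r)).card := by
    rcases min_le_iff.1 hcd with h | h <;> omega
  have hpos : 1 ≤ (charBall u r).card := Finset.card_pos.2 ⟨0, zero_mem_charBall u hr⟩
  have hR : ((charBall u r).card : ℝ) ≤ 1 + (charBall u (q * r)).card / q := by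
    have : ((q * ((charBall u r).card - 1) + 1 : ℕ) : ℝ) ≤ (charBall u (q * r)).card := by
      exact_mod_cast hcd'
    push_cast [Nat.cast_sub hpos] at this
    have hq' : (0 : ℝ) < q := by exact_mod_cast hq
    rw [← sub_le_iff_le_add', le_div_iff₀ hq']
    linarith
  have hterm : ∀ t, Real.exp (-(charDist u t ^ 2 / 8)) ≤
      (if t ∈ charBall u r then 1 else 0) + 1 / p := by
    intro t
    split_ifs with ht
    · have : Real.exp (-(charDist u t ^ 2 / 8)) ≤ 1 := by
        rw [Real.exp_le_one_iff]
        have := sq_nonneg (charDist u t)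
        linarith
      have : (0 : ℝ) ≤ 1 / p := by positivity
      linarith
    · rw [mem_charBall, not_le] at ht
      rw [zero_add, one_div, ← Real.exp_log hp0, ← Real.exp_neg, Real.exp_le_exp]
      have := pow_le_pow_left₀ hr ht.le 2
      linarith
  refine (Finset.sum_le_sum fun t _ => hterm t).trans ?_
  rw [Finset.sum_add_distrib, Finset.sum_const, Finset.card_univ, ZMod.card, nsmul_eq_mul,
    mul_one_div_cancel hp0.ne']
  simp only [Finset.sum_ite_mem, Finset.univ_inter, Finset.sum_const, nsmul_eq_mul, mul_one]
  linarith

end Halasz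

section Counting

theorem sum_biUnion_le_of_nonneg {α β : Type*} [DecidableEq α] [DecidableEq β] (s : Finset β)
    (W : β → Finset α) (f : α → ℝ) (hf : ∀ a, 0 ≤ f a) :
    ∑ a ∈ s.biUnion W, f a ≤ ∑ b ∈ s, ∑ a ∈ W b, f a := by
  induction s using Finset.induction_on with
  | empty => simp
  | insert b s hb ih =>
    rw [Finset.biUnion_insert, Finset.sum_insert hb]
    have h1 := Finset.sum_union_inter (s₁ := W b) (s₂ := s.biUnion W) (f := f)
    have h2 := Finset.sum_nonneg (s := W b ∩ s.biUnion W) fun a _ => hf a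
    linarith

variable {ι : Type*} [Fintype ι] {p : ℕ} [Fact p.Prime]

/-- The elements `x` such that `Re ψ (t i * x) ≥ 1 / 2` for all `i`. -/
def bohrSet {p : ℕ} [NeZero p] {L : ℕ} (t : Fin L → ZMod p) : Finset (ZMod p) := by
  classical
  exact Finset.univ.filter (fun x => ∀ i, 1 / 2 ≤ (ZMod.stdAddChar (t i * x) : ℂ).re)

theorem mem_bohrSet {L : ℕ} {t : Fin L → ZMod p} {x : ZMod p} :
    x ∈ bohrSet t ↔ ∀ i, 1 / 2 ≤ (ZMod.stdAddChar (t i * x) : ℂ).re := by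
  simp [bohrSet]

theorem zero_mem_bohrSet {L : ℕ} (t : Fin L → ZMod p) : 0 ∈ bohrSet t := by
  rw [mem_bohrSet]
  intro i
  simp
  norm_num

theorem neg_one_le_re_stdAddChar (x : ZMod p) : -1 ≤ (ZMod.stdAddChar x : ℂ).re := by
  have h := Complex.abs_re_le_norm (ZMod.stdAddChar x)
  rw [AddChar.norm_apply] at h
  exact (abs_le.1 h).1

open scoped Classical in
/-- Elements with a small character average over `T` are thinned out by some element of `T`. -/
theorem exists_thinning (T : Finset (ZMod p)) (hT : T.Nonempty) (X : Finset (ZMod p))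
    (hX : ∀ x ∈ X, ∑ t ∈ T, (ZMod.stdAddChar (t * x) : ℂ).re < T.card / 4) :
    ∃ t ∈ T, 6 * (X.filter (fun x => 1 / 2 ≤ (ZMod.stdAddChar (t * x) : ℂ).re)).card ≤
      5 * X.card := by
  refine Finset.exists_le_of_sum_le hT ?_
  have h1 : ∀ x ∈ X, 6 * (T.filter (fun t => 1 / 2 ≤ (ZMod.stdAddChar (t * x) : ℂ).re)).card ≤
      5 * T.card := by
    intro x hx
    have h2 : ∑ t ∈ T, ((3 / 2 : ℝ) * (if 1 / 2 ≤ (ZMod.stdAddChar (t * x) : ℂ).re then 1 else 0)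
        - 1) ≤ ∑ t ∈ T, (ZMod.stdAddChar (t * x) : ℂ).re := by
      refine Finset.sum_le_sum fun t _ => ?_
      split_ifs with h
      · linarith
      · have := neg_one_le_re_stdAddChar (t * x)
        linarith
    rw [Finset.sum_sub_distrib, ← Finset.mul_sum, Finset.sum_boole] at h2
    simp only [Finset.sum_const, nsmul_eq_mul, mul_one] at h2
    have h3 := hX x hx
    have : (6 * (T.filter (fun t => 1 / 2 ≤ (ZMod.stdAddChar (t * x) : ℂ).re)).card : ℝ) ≤
      5 * T.card := by linarith
    exact_mod_cast this
  have h4 := Finset.sum_le_sum h1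
  simp only [Finset.card_filter, Finset.sum_const, smul_eq_mul] at h4 ⊢
  rw [← Finset.mul_sum] at h4 ⊢
  rw [Finset.sum_comm]
  linarith

open scoped Classical in
theorem exists_iterated_thinning (T : Finset (ZMod p)) (hT : T.Nonempty) (X : Finset (ZMod p))
    (hX : ∀ x ∈ X, ∑ t ∈ T, (ZMod.stdAddChar (t * x) : ℂ).re < T.card / 4) (L : ℕ) :
    ∃ t : Fin L → ZMod p, (∀ i, t i ∈ T) ∧
      6 ^ L * (X.filter (fun x => x ∈ bohrSet t)).card ≤ 5 ^ L * X.card := by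
  induction L with
  | zero =>
    refine ⟨Fin.elim0, fun i => i.elim0, ?_⟩
    simpa using Finset.card_filter_le _ _
  | succ L ih =>
    obtain ⟨t, htT, ht⟩ := ih
    obtain ⟨a, haT, ha⟩ := exists_thinning T hT (X.filter (fun x => x ∈ bohrSet t))
      (fun x hx => hX x (Finset.mem_filter.1 hx).1)
    refine ⟨Fin.cons a t, fun i => Fin.cases haT htT i, ?_⟩
    have heq : X.filter (fun x => x ∈ bohrSet (Fin.cons a t : Fin (L + 1) → ZMod p)) =
        (X.filter (fun x => x ∈ bohrSet t)).filter
          (fun x => 1 / 2 ≤ (ZMod.stdAddChar (a * x) : ℂ).re) := by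
      ext x
      simp only [Finset.mem_filter, mem_bohrSet, Fin.forall_fin_succ, Fin.cons_zero, Fin.cons_succ]
      tauto
    rw [heq]
    calc _ = 6 ^ L * (6 * ((X.filter (fun x => x ∈ bohrSet t)).filter
          (fun x => 1 / 2 ≤ (ZMod.stdAddChar (a * x) : ℂ).re)).card) := by ring
      _ ≤ 6 ^ L * (5 * (X.filter (fun x => x ∈ bohrSet t)).card) := Nat.mul_le_mul_left _ ha
      _ = 5 * (6 ^ L * (X.filter (fun x => x ∈ bohrSet t)).card) := by ring
      _ ≤ 5 * (5 ^ L * X.card) := Nat.mul_le_mul_left _ ht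
      _ = _ := by ring

theorem sum_norm_sq_charSum (T : Finset (ZMod p)) :
    ∑ x : ZMod p, ‖∑ t ∈ T, (ZMod.stdAddChar (t * x) : ℂ)‖ ^ 2 = p * T.card := by
  classical
  have h : ∑ x : ZMod p, ((‖∑ t ∈ T, (ZMod.stdAddChar (t * x) : ℂ)‖ ^ 2 : ℝ) : ℂ) =
      p * T.card := by
    have h1 : ∀ x : ZMod p, ((‖∑ t ∈ T, (ZMod.stdAddChar (t * x) : ℂ)‖ ^ 2 : ℝ) : ℂ) =
        ∑ t ∈ T, ∑ s ∈ T, (ZMod.stdAddChar (x * (t - s)) : ℂ) := by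
      intro x
      rw [← Complex.normSq_eq_norm_sq, ← Complex.mul_conj, map_sum, Finset.sum_mul_sum]
      refine Finset.sum_congr rfl fun t _ => Finset.sum_congr rfl fun s _ => ?_
      rw [← AddChar.map_neg_eq_conj, ← AddChar.map_add_eq_mul]
      ring_nf
    simp_rw [h1]
    rw [Finset.sum_comm]
    simp_rw [Finset.sum_comm (s := Finset.univ),
      AddChar.sum_mulShift _ (ZMod.isPrimitive_stdAddChar p), sub_eq_zero]
    simp [ZMod.card, mul_comm]
  exact_mod_cast h

/-- Dual bound: few elements have a large character average over `T`. -/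
theorem card_mul_card_le (T : Finset (ZMod p)) (hT : T.Nonempty) (X : Finset (ZMod p))
    (hX : ∀ x ∈ X, (T.card : ℝ) / 4 ≤ ∑ t ∈ T, (ZMod.stdAddChar (t * x) : ℂ).re) :
    X.card * T.card ≤ 16 * p := by
  have hpos : (0 : ℝ) < T.card := by exact_mod_cast hT.card_pos
  have h1 : ∑ x ∈ X, ((T.card : ℝ) / 4) ^ 2 ≤ (p : ℝ) * T.card := by
    rw [← sum_norm_sq_charSum]
    refine (Finset.sum_le_sum fun x hx => ?_).trans
      (Finset.sum_le_sum_of_subset_of_nonneg (Finset.subset_univ X) fun _ _ _ => by positivity)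
    refine pow_le_pow_left₀ (by positivity) ((hX x hx).trans ?_) 2
    rw [← Complex.re_sum]
    exact Complex.re_le_norm _
  rw [Finset.sum_const, nsmul_eq_mul] at h1
  have h2 : (X.card : ℝ) * T.card ≤ 16 * p := by
    refine le_of_mul_le_mul_right ?_ hpos
    linarith
  exact_mod_cast h2

/-- A large set `T` contains few elements whose joint Bohr set is small. -/
theorem exists_bohrSet_card_mul_le (T : Finset (ZMod p)) (hT : T.Nonempty) {L : ℕ}
    (hL : 5 ^ L * p < 6 ^ L) :
    ∃ t : Fin L → ZMod p, (∀ i, t i ∈ T) ∧ (bohrSet t).card * T.card ≤ 16 * p := by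
  classical
  set X := Finset.univ.filter
    (fun x : ZMod p => ∑ t ∈ T, (ZMod.stdAddChar (t * x) : ℂ).re < T.card / 4) with hX
  obtain ⟨t, htT, ht⟩ := exists_iterated_thinning T hT X (fun x hx => (Finset.mem_filter.1 hx).2) L
  refine ⟨t, htT, card_mul_card_le T hT _ fun x hx => ?_⟩
  by_contra hlt
  have hmem : x ∈ X.filter (fun x => x ∈ bohrSet t) := by
    simpa [hX, hx] using hlt
  have h1 : 1 ≤ (X.filter (fun x => x ∈ bohrSet t)).card := Finset.card_pos.2 ⟨x, hmem⟩
  have h2 : X.card ≤ p := (Finset.card_le_univ X).trans_eq (ZMod.card p)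
  have h3 := Nat.mul_le_mul_left (6 ^ L) h1
  have h4 := Nat.mul_le_mul_left (5 ^ L) h2
  omega

theorem card_not_mem_bohrSet_le (u : ι → ZMod p) {R : ℝ} {L : ℕ} (t : Fin L → ZMod p)
    (ht : ∀ i, t i ∈ charBall u R) :
    ((Finset.univ.filter (fun j => u j ∉ bohrSet t)).card : ℝ) ≤ L * R ^ 2 := by
  classical
  have h1 : ∀ j ∈ Finset.univ.filter (fun j => u j ∉ bohrSet t),
      (1 : ℝ) ≤ ∑ i, ‖(ZMod.stdAddChar (t i * u j) - 1 : ℂ)‖ ^ 2 := by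
    intro j hj
    simp only [Finset.mem_filter, Finset.mem_univ, true_and, mem_bohrSet, not_forall, not_le] at hj
    obtain ⟨i, hi⟩ := hj
    refine le_trans ?_ (Finset.single_le_sum (f := fun i =>
      ‖(ZMod.stdAddChar (t i * u j) - 1 : ℂ)‖ ^ 2) (fun _ _ => by positivity) (Finset.mem_univ i))
    have h2 : ‖(ZMod.stdAddChar (t i * u j) : ℂ)‖ ^ 2 = 1 := by simp
    rw [← Complex.normSq_eq_norm_sq, Complex.normSq_apply] at h2 ⊢
    simp only [Complex.sub_re, Complex.sub_im, Complex.one_re, Complex.one_im]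
    linarith
  calc ((Finset.univ.filter (fun j => u j ∉ bohrSet t)).card : ℝ)
      = ∑ j ∈ Finset.univ.filter (fun j => u j ∉ bohrSet t), (1 : ℝ) := by simp
    _ ≤ ∑ j ∈ Finset.univ.filter (fun j => u j ∉ bohrSet t),
          ∑ i, ‖(ZMod.stdAddChar (t i * u j) - 1 : ℂ)‖ ^ 2 := Finset.sum_le_sum h1
    _ ≤ ∑ j, ∑ i, ‖(ZMod.stdAddChar (t i * u j) - 1 : ℂ)‖ ^ 2 :=
        Finset.sum_le_sum_of_subset_of_nonneg (Finset.subset_univ _) fun _ _ _ => by positivity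
    _ = ∑ i, charDist u (t i) ^ 2 := by
        rw [Finset.sum_comm]
        simp_rw [charDist_sq]
    _ ≤ ∑ _i : Fin L, R ^ 2 := Finset.sum_le_sum fun i _ =>
        pow_le_pow_left₀ (charDist_nonneg _ _) (mem_charBall.1 (ht i)) 2
    _ = L * R ^ 2 := by simp

open scoped Classical in
/-- The number of vectors with support `S` and all but `b` coordinates in `G`. -/
theorem card_support_eq_le {F : Type*} [Fintype F] [Zero F] (S : Finset ι) (G : Finset F)
    (hG : 0 ∈ G) (b : ℕ) :
    (Finset.univ.filter (fun u : ι → F => Finset.univ.filter (fun j => u j ≠ 0) = S ∧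
      (Finset.univ.filter (fun j => u j ∉ G)).card ≤ b)).card ≤
      2 ^ S.card * (Fintype.card F ^ b * G.card ^ S.card) := by
  have hF : 0 < Fintype.card F := Fintype.card_pos_iff.2 ⟨0⟩
  have hsub : Finset.univ.filter (fun u : ι → F => Finset.univ.filter (fun j => u j ≠ 0) = S ∧
      (Finset.univ.filter (fun j => u j ∉ G)).card ≤ b) ⊆
      (S.powerset.filter (fun J => J.card ≤ b)).biUnion (fun J => Fintype.piFinset
        (fun j => if j ∈ J then Finset.univ else if j ∈ S then G else {0})) := by
    intro u hu
    simp only [Finset.mem_filter, Finset.mem_univ, true_and] at hu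
    obtain ⟨hS, hb⟩ := hu
    refine Finset.mem_biUnion.2 ⟨Finset.univ.filter (fun j => u j ∉ G), ?_, ?_⟩
    · refine Finset.mem_filter.2 ⟨Finset.mem_powerset.2 fun j hj => ?_, hb⟩
      rw [← hS, Finset.mem_filter]
      refine ⟨Finset.mem_univ _, fun h0 => (Finset.mem_filter.1 hj).2 ?_⟩
      rw [h0]
      exact hG
    · rw [Fintype.mem_piFinset]
      intro j
      split_ifs with h1 h2
      · exact Finset.mem_univ _
      · simpa using h1
      · rw [← hS] at h2
        simpa using h2
  refine (Finset.card_le_card hsub).trans (Finset.card_biUnion_le.trans ?_)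
  refine (Finset.sum_le_card_nsmul _ _ (Fintype.card F ^ b * G.card ^ S.card) fun J hJ => ?_).trans ?_
  · rw [Fintype.card_piFinset]
    have hJb := (Finset.mem_filter.1 hJ).2
    have hG1 : 1 ≤ G.card := Finset.card_pos.2 ⟨0, hG⟩
    calc _ ≤ ∏ j, ((if j ∈ J then Fintype.card F else 1) * (if j ∈ S then G.card else 1)) := by
          refine Finset.prod_le_prod' fun j _ => ?_
          split_ifs <;> simp
          exact Nat.le_mul_of_pos_right _ hG1
      _ = Fintype.card F ^ J.card * G.card ^ S.card := by
          rw [Finset.prod_mul_distrib]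
          simp [Finset.prod_ite_mem]
      _ ≤ _ := Nat.mul_le_mul_right _ (Nat.pow_le_pow_right hF hJb)
  · rw [smul_eq_mul]
    refine Nat.mul_le_mul_right _ ?_
    rw [← Finset.card_powerset]
    exact Finset.card_filter_le _ _

theorem two_mul_orthCount_le (hp : p ≠ 2) (u : ι → ZMod p) (hu : u ≠ 0) :
    2 * orthCount u ≤ 2 ^ Fintype.card ι := by
  classical
  have h2 : (2 : ZMod p) ≠ 0 := by
    intro h
    have : ((2 : ℕ) : ZMod p) = 0 := by exact_mod_cast h
    rw [ZMod.natCast_eq_zero_iff] at this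
    exact hp ((Nat.prime_dvd_prime_iff_eq Fact.out Nat.prime_two).1 this)
  obtain ⟨k, hk⟩ := Function.ne_iff.1 hu
  set A := Finset.univ.filter (fun r : ι → Bool => ∑ j, boolSign (ZMod p) (r j) * u j = 0) with hA
  have hcount : orthCount u = A.card := by
    unfold orthCount
    rw [Set.ncard_eq_toFinset_card', Set.toFinset_ofPred]
  let f : (ι → Bool) → (ι → Bool) := fun r => Function.update r k (!r k)
  have hff : Function.Involutive f := by
    intro r
    simp [f]
  have hdisj : Disjoint A (A.image f) := by
    rw [Finset.disjoint_left]
    intro r hr hr'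
    obtain ⟨r', hr'', rfl⟩ := Finset.mem_image.1 hr'
    have h1 := (Finset.mem_filter.1 hr).2
    have h3 := (Finset.mem_filter.1 hr'').2
    rw [← Finset.add_sum_erase _ _ (Finset.mem_univ k)] at h1 h3
    have h4 : ∑ j ∈ Finset.univ.erase k, boolSign (ZMod p) (f r' j) * u j =
        ∑ j ∈ Finset.univ.erase k, boolSign (ZMod p) (r' j) * u j := by
      refine Finset.sum_congr rfl fun j hj => ?_
      simp [f, Finset.ne_of_mem_erase hj]
    rw [h4, ← h3, add_left_inj] at h1
    have h5 : (2 : ZMod p) * u k = 0 := by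
      cases hb : r' k <;> simp [f, boolSign, hb] at h1
      · linear_combination h1
      · linear_combination -h1
    exact (mul_ne_zero h2 hk) h5
  rw [hcount]
  calc 2 * A.card = (A ∪ A.image f).card := by
        rw [Finset.card_union_of_disjoint hdisj, Finset.card_image_of_injective _ hff.injective]
        ring
    _ ≤ _ := (Finset.card_le_univ _).trans (by simp)

open scoped Classical in
/-- Moment bound for vectors with a fixed large support. -/
theorem sum_orthCount_pow_le (hp : p ≠ 2) (S : Finset ι) {q L b h : ℕ} (hq : 0 < q) {r : ℝ}
    (hr : 0 ≤ r) (hr8 : 8 * Real.log p ≤ r ^ 2) (hS : (q * r) ^ 2 < 2 * S.card)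
    (hL : 5 ^ L * p < 6 ^ L) (hb : (L : ℝ) * (q * r) ^ 2 ≤ b) (hSh : S.card ≤ h) :
    ∑ u ∈ Finset.univ.filter (fun u : ι → ZMod p => Finset.univ.filter (fun j => u j ≠ 0) = S),
      (orthCount u : ℝ) ^ h ≤
    (2 ^ Fintype.card ι) ^ h * ((p : ℝ) ^ (L + b) * 4 ^ h *
      (2 ^ h * (p : ℝ) ^ S.card / (p : ℝ) ^ h + (16 / q) ^ h)) := by
  have hp0 : (0 : ℝ) < p := by exact_mod_cast (Fact.out : p.Prime).pos
  have hq0 : (0 : ℝ) < q := by exact_mod_cast hq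
  set W : (Fin L → ZMod p) → Finset (ι → ZMod p) := fun t =>
    (Finset.univ.filter (fun u : ι → ZMod p => Finset.univ.filter (fun j => u j ≠ 0) = S ∧
      (Finset.univ.filter (fun j => u j ∉ bohrSet t)).card ≤ b)).filter (fun u =>
        (bohrSet t).card * (charBall u (q * r)).card ≤ 16 * p) with hW
  have hcover : Finset.univ.filter
      (fun u : ι → ZMod p => Finset.univ.filter (fun j => u j ≠ 0) = S) ⊆
      Finset.univ.biUnion W := by
    intro u hu
    have hu' := (Finset.mem_filter.1 hu).2
    obtain ⟨t, ht, hcard⟩ := exists_bohrSet_card_mul_le (charBall u (q * r))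
      ⟨0, zero_mem_charBall u (by positivity)⟩ hL
    refine Finset.mem_biUnion.2 ⟨t, Finset.mem_univ _, ?_⟩
    simp only [hW, Finset.mem_filter, Finset.mem_univ, true_and]
    refine ⟨⟨hu', ?_⟩, hcard⟩
    exact_mod_cast (card_not_mem_bohrSet_le u t ht).trans hb
  have hWsum : ∀ t, ∑ u ∈ W t, (orthCount u : ℝ) ^ h ≤
      (2 ^ Fintype.card ι) ^ h * ((p : ℝ) ^ b * 4 ^ h *
      (2 ^ h * (p : ℝ) ^ S.card / (p : ℝ) ^ h + (16 / q) ^ h)) := by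
    intro t
    set g := (bohrSet t).card with hg
    have hg1 : 1 ≤ g := Finset.card_pos.2 ⟨0, zero_mem_bohrSet t⟩
    have hg0 : (0 : ℝ) < g := by exact_mod_cast hg1
    have hg1' : (1 : ℝ) ≤ g := by exact_mod_cast hg1
    have hgp : (g : ℝ) ≤ p := by
      exact_mod_cast (Finset.card_le_univ _).trans_eq (ZMod.card p)
    have hterm : ∀ u ∈ W t, (orthCount u : ℝ) ^ h ≤
        (2 ^ Fintype.card ι) ^ h * (2 ^ h * ((2 / p) ^ h + (16 / (g * q)) ^ h)) := by
      intro u hu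
      simp only [hW, Finset.mem_filter, Finset.mem_univ, true_and] at hu
      obtain ⟨⟨huS, _⟩, hcard⟩ := hu
      have h1 := mul_orthCount_le_card_charBall hp u hq hr hr8 (by rw [huS]; exact hS)
      have h2 : (g : ℝ) * (charBall u (q * r)).card ≤ 16 * p := by exact_mod_cast hcard
      have h3 : (orthCount u : ℝ) ≤ 2 ^ Fintype.card ι * (2 / p + 16 / (g * q)) := by
        rw [← mul_le_mul_iff_right₀ hp0]
        refine h1.trans ?_
        rw [mul_left_comm]
        refine mul_le_mul_of_nonneg_left ?_ (by positivity)
        rw [mul_add, mul_div_cancel₀ _ hp0.ne', add_le_add_iff_left, div_le_iff₀ hq0]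
        have : (p : ℝ) * (16 / (g * q)) * q = 16 * p / g := by field_simp
        rw [this, le_div_iff₀ hg0]
        linarith
      refine (pow_le_pow_left₀ (by positivity) h3 h).trans ?_
      rw [mul_pow]
      refine mul_le_mul_of_nonneg_left ?_ (by positivity)
      refine (add_pow_le (by positivity) (by positivity) h).trans ?_
      refine mul_le_mul_of_nonneg_right ?_ (by positivity)
      exact pow_le_pow_right₀ (by norm_num) (Nat.sub_le _ _)
    have hcardW : ((W t).card : ℝ) ≤ 2 ^ S.card * ((p : ℝ) ^ b * (g : ℝ) ^ S.card) := by
      have hsupp := card_support_eq_le S (bohrSet t) (zero_mem_bohrSet t) b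
      rw [ZMod.card] at hsupp
      have : (W t).card ≤ 2 ^ S.card * (p ^ b * g ^ S.card) := by
        refine (Finset.card_filter_le _ _).trans ((le_of_eq ?_).trans hsupp)
        congr!
      exact_mod_cast this
    refine (Finset.sum_le_card_nsmul _ _ _ hterm).trans ?_
    rw [nsmul_eq_mul]
    refine (mul_le_mul_of_nonneg_right hcardW (by positivity)).trans ?_
    have e1 : (2 : ℝ) ^ S.card ≤ 2 ^ h := pow_le_pow_right₀ (by norm_num) hSh
    have e2 : (g : ℝ) ^ S.card * (2 / p) ^ h ≤ 2 ^ h * (p : ℝ) ^ S.card / (p : ℝ) ^ h := by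
      rw [div_pow, mul_div_assoc', mul_comm]
      gcongr
    have e3 : (g : ℝ) ^ S.card * (16 / (g * q)) ^ h ≤ (16 / q) ^ h := by
      have : (16 / (g * q) : ℝ) ^ h = (16 / q) ^ h / (g : ℝ) ^ h := by
        rw [← div_pow]
        congr 1
        field_simp
      rw [this, mul_div_assoc', div_le_iff₀ (by positivity), mul_comm]
      gcongr
    calc _ = (2 ^ Fintype.card ι) ^ h * ((p : ℝ) ^ b * (2 ^ S.card * 2 ^ h) *
          ((g : ℝ) ^ S.card * (2 / p) ^ h + (g : ℝ) ^ S.card * (16 / (g * q)) ^ h)) := by ring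
      _ ≤ (2 ^ Fintype.card ι) ^ h * ((p : ℝ) ^ b * (2 ^ h * 2 ^ h) *
          (2 ^ h * (p : ℝ) ^ S.card / (p : ℝ) ^ h + (16 / q) ^ h)) := by gcongr
      _ = _ := by
          rw [← mul_pow]
          norm_num
  refine (Finset.sum_le_sum_of_subset_of_nonneg hcover fun _ _ _ => by positivity).trans ?_
  refine (sum_biUnion_le_of_nonneg _ _ _ fun _ => by positivity).trans ?_
  refine (Finset.sum_le_sum fun t _ => hWsum t).trans (le_of_eq ?_)
  rw [Finset.sum_const, Finset.card_univ, Fintype.card_fun, ZMod.card, Fintype.card_fin,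
    nsmul_eq_mul, pow_add]
  push_cast
  ring

end Counting

section UnionBound

theorem prob_le_one {α : Type*} [Fintype α] (P : α → Prop) : prob P ≤ 1 := by
  unfold prob
  refine div_le_one_of_le₀ ?_ (by positivity)
  rw [← Nat.card_eq_fintype_card]
  exact_mod_cast Set.ncard_le_card _

theorem one_sub_le_prob {α : Type*} [Fintype α] [Nonempty α] (P : α → Prop) {c : ℝ}
    (hc : (({a | ¬ P a} : Set α).ncard : ℝ) ≤ Fintype.card α * c) : 1 - c ≤ prob P := by
  unfold prob
  have hpos : (0 : ℝ) < Fintype.card α := by exact_mod_cast Fintype.card_pos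
  rw [le_div_iff₀ hpos]
  have h := Set.ncard_add_ncard_compl {a | P a}
  rw [Nat.card_eq_fintype_card] at h
  have h' : (({a | P a} : Set α).ncard : ℝ) + ({a | ¬ P a} : Set α).ncard = Fintype.card α := by
    exact_mod_cast h
  linarith

/-- Bound for `2⁻ʰᴺ ∑ orthCount u ^ h` over the vectors `u` with a given support of size `k`. -/
def supportCost (p q L b h k₀ k : ℕ) : ℝ :=
  if k ≤ k₀ then (2 * p : ℝ) ^ k / 2 ^ h
  else (p : ℝ) ^ (L + b) * 4 ^ h * (2 ^ h * (p : ℝ) ^ k / (p : ℝ) ^ h + (16 / q) ^ h)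

open scoped Classical in
theorem sum_orthCount_pow_le_supportCost {ι : Type*} [Fintype ι] {p : ℕ} [Fact p.Prime]
    (hp : p ≠ 2) (S : Finset ι) {q L b h k₀ : ℕ} (hq : 0 < q) {r : ℝ}
    (hr : 0 ≤ r) (hr8 : 8 * Real.log p ≤ r ^ 2) (hk₀ : (q * r) ^ 2 ≤ 2 * k₀)
    (hL : 5 ^ L * p < 6 ^ L) (hb : (L : ℝ) * (q * r) ^ 2 ≤ b) (hS1 : 1 ≤ S.card)
    (hSh : S.card ≤ h) :
    ∑ u ∈ Finset.univ.filter (fun u : ι → ZMod p => Finset.univ.filter (fun j => u j ≠ 0) = S),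
      (orthCount u : ℝ) ^ h ≤
    (2 ^ Fintype.card ι) ^ h * supportCost p q L b h k₀ S.card := by
  unfold supportCost
  split_ifs with hk
  · have hterm : ∀ u ∈ Finset.univ.filter
        (fun u : ι → ZMod p => Finset.univ.filter (fun j => u j ≠ 0) = S),
        (orthCount u : ℝ) ^ h ≤ (2 ^ Fintype.card ι / 2) ^ h := by
      intro u hu
      have hu' := (Finset.mem_filter.1 hu).2
      refine pow_le_pow_left₀ (by positivity) ?_ h
      have hu0 : u ≠ 0 := by
        rintro rfl
        simp only [Pi.zero_apply, ne_eq, not_true_eq_false, Finset.filter_false] at hu'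
        rw [← hu'] at hS1
        simp at hS1
      have : (2 * orthCount u : ℝ) ≤ 2 ^ Fintype.card ι := by
        exact_mod_cast two_mul_orthCount_le hp u hu0
      linarith
    refine (Finset.sum_le_card_nsmul _ _ _ hterm).trans ?_
    rw [nsmul_eq_mul]
    have hsupp := card_support_eq_le S (Finset.univ : Finset (ZMod p)) (Finset.mem_univ _) 0
    rw [Finset.card_univ, ZMod.card, pow_zero, one_mul, ← mul_pow] at hsupp
    have hcard : (Finset.univ.filter
        (fun u : ι → ZMod p => Finset.univ.filter (fun j => u j ≠ 0) = S)).card ≤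
        (2 * p) ^ S.card := by
      refine le_trans (Finset.card_le_card fun u hu => ?_) hsupp
      simp only [Finset.mem_filter, Finset.mem_univ, true_and, not_true_eq_false,
        Finset.filter_false, Finset.card_empty, le_refl, and_true] at hu ⊢
      convert hu
    have hcard' : ((Finset.univ.filter
        (fun u : ι → ZMod p => Finset.univ.filter (fun j => u j ≠ 0) = S)).card : ℝ) ≤
        (2 * p) ^ S.card := by exact_mod_cast hcard
    refine (mul_le_mul_of_nonneg_right hcard' (by positivity)).trans (le_of_eq ?_)
    rw [div_pow]
    ring
  · refine sum_orthCount_pow_le hp S hq hr hr8 (hk₀.trans_lt ?_) hL hb hSh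
    have : (k₀ : ℝ) < S.card := by exact_mod_cast not_le.1 hk
    linarith

open scoped Classical in
/-- Union bound over the supports of sparse kernel vectors modulo `p`. -/
theorem one_sub_le_prob_no_sparse_kernel {h N K : ℕ} {p : ℕ} [Fact p.Prime] (hp : p ≠ 2)
    {q L b k₀ : ℕ} (hq : 0 < q) {r x E : ℝ}
    (hr : 0 ≤ r) (hr8 : 8 * Real.log p ≤ r ^ 2) (hk₀ : (q * r) ^ 2 ≤ 2 * k₀)
    (hL : 5 ^ L * p < 6 ^ L) (hb : (L : ℝ) * (q * r) ^ 2 ≤ b) (hKh : K ≤ h) (hx : x < K + 1)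
    (hE : ∀ k, 1 ≤ k → k ≤ K → N.choose k * supportCost p q L b h k₀ k ≤ E) :
    1 - K * E ≤ prob (fun s : Fin h → Fin N → Bool =>
        ∀ u : Fin N → ℝ, u ≠ 0 → (hw u : ℝ) ≤ x → (signMat s).mulVec u ≠ 0) := by
  refine one_sub_le_prob _ ?_
  set V : Finset (Fin N) → Finset (Fin N → ZMod p) := fun S =>
    Finset.univ.filter (fun u => Finset.univ.filter (fun j => u j ≠ 0) = S) with hV
  set O : (Fin N → ZMod p) → Finset (Fin h → Fin N → Bool) := fun v =>
    Finset.univ.filter (fun s => ∀ i, ∑ j, boolSign (ZMod p) (s i j) * v j = 0) with hO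
  have hOcard : ∀ v, (O v).card = orthCount v ^ h := by
    intro v
    rw [← ncard_forall_rows, Set.ncard_eq_toFinset_card', Set.toFinset_ofPred]
  have hsub : {s : Fin h → Fin N → Bool | ¬ ∀ u : Fin N → ℝ, u ≠ 0 → (hw u : ℝ) ≤ x →
      (signMat s).mulVec u ≠ 0} ⊆ ((Finset.Icc 1 K).biUnion fun k =>
        (Finset.powersetCard k Finset.univ).biUnion fun S => (V S).biUnion O : Finset _) := by
    intro s hs
    simp only [Set.mem_ofPred_eq, not_forall, not_not] at hs
    obtain ⟨u, hu0, hux, hus⟩ := hs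
    obtain ⟨v, hv0, hvu, hvs⟩ := exists_mod_kernel p s u hu0 hus
    have hcK : (Finset.univ.filter (fun j => v j ≠ 0)).card ≤ K := by
      refine hvu.trans ?_
      have : (hw u : ℝ) < (K + 1 : ℕ) := by push_cast; linarith
      exact Nat.lt_succ_iff.1 (by exact_mod_cast this)
    obtain ⟨j, hj⟩ := Function.ne_iff.1 hv0
    have hc1 : 1 ≤ (Finset.univ.filter (fun j => v j ≠ 0)).card :=
      Finset.card_pos.2 ⟨j, by simpa using hj⟩
    simp only [Finset.coe_biUnion, Set.mem_iUnion, Finset.mem_coe]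
    refine ⟨_, Finset.mem_Icc.2 ⟨hc1, hcK⟩, Finset.univ.filter (fun j => v j ≠ 0),
      Finset.mem_powersetCard.2 ⟨Finset.subset_univ _, rfl⟩, v, ?_, ?_⟩
    · simp only [hV, Finset.mem_filter, Finset.mem_univ, true_and]
    · simpa [hO] using hvs
  have hcard := Set.ncard_le_ncard hsub (Finset.finite_toSet _)
  rw [Set.ncard_coe_finset] at hcard
  have hcard2 : (({s : Fin h → Fin N → Bool | ¬ ∀ u : Fin N → ℝ, u ≠ 0 → (hw u : ℝ) ≤ x →
      (signMat s).mulVec u ≠ 0}.ncard : ℕ) : ℝ) ≤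
      ∑ k ∈ Finset.Icc 1 K, ∑ S ∈ Finset.powersetCard k Finset.univ, ∑ v ∈ V S,
        (orthCount v : ℝ) ^ h := by
    have : _ ≤ ∑ k ∈ Finset.Icc 1 K, ∑ S ∈ Finset.powersetCard k Finset.univ, ∑ v ∈ V S,
        orthCount v ^ h :=
      hcard.trans (Finset.card_biUnion_le.trans (Finset.sum_le_sum fun k _ =>
        Finset.card_biUnion_le.trans (Finset.sum_le_sum fun S _ =>
        Finset.card_biUnion_le.trans (Finset.sum_le_sum fun v _ => (hOcard v).le))))
    exact_mod_cast this
  refine hcard2.trans ?_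
  have htot : (Fintype.card (Fin h → Fin N → Bool) : ℝ) = (2 ^ N) ^ h := by simp
  rw [htot]
  have hk : ∀ k ∈ Finset.Icc 1 K, ∑ S ∈ Finset.powersetCard k Finset.univ, ∑ v ∈ V S,
      (orthCount v : ℝ) ^ h ≤ (2 ^ N) ^ h * E := by
    intro k hk
    obtain ⟨hk1, hkK⟩ := Finset.mem_Icc.1 hk
    have hS : ∀ S ∈ Finset.powersetCard k (Finset.univ : Finset (Fin N)),
        ∑ v ∈ V S, (orthCount v : ℝ) ^ h ≤ (2 ^ N) ^ h * supportCost p q L b h k₀ k := by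
      intro S hS
      have hSk := (Finset.mem_powersetCard.1 hS).2
      have := sum_orthCount_pow_le_supportCost hp S (h := h) hq hr hr8 hk₀ hL hb (by omega)
        (by omega)
      rw [Fintype.card_fin, hSk] at this
      convert this
    refine (Finset.sum_le_card_nsmul _ _ _ hS).trans ?_
    rw [Finset.card_powersetCard, Finset.card_univ, Fintype.card_fin, nsmul_eq_mul, mul_left_comm]
    exact mul_le_mul_of_nonneg_left (hE k hk1 hkK) (by positivity)
  refine (Finset.sum_le_card_nsmul _ _ _ hk).trans (le_of_eq ?_)
  rw [Nat.card_Icc, nsmul_eq_mul, Nat.add_sub_cancel]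
  ring

end UnionBound

section Asymptotics

theorem choose_le_exp_mul_div_pow (N k : ℕ) (hk : 0 < k) :
    (N.choose k : ℝ) ≤ (Real.exp 1 * (N / k)) ^ k := by
  have hk' : (0 : ℝ) < k := by exact_mod_cast hk
  have h1 := Real.pow_div_factorial_le_exp (x := k) hk'.le k
  have h2 := Nat.choose_le_pow_div (α := ℝ) k N
  calc (N.choose k : ℝ) ≤ (N : ℝ) ^ k / k.factorial := h2
    _ = (N / k : ℝ) ^ k * ((k : ℝ) ^ k / k.factorial) := by rw [div_pow]; field_simp
    _ ≤ (N / k : ℝ) ^ k * Real.exp k := by gcongr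
    _ = _ := by rw [mul_pow, ← Real.exp_nat_mul, mul_one, mul_comm]

theorem dOf_le {δ : ℝ} (hδ : δ ≤ 1) (h : ℕ) : dOf δ h ≤ h := by
  unfold dOf
  refine Nat.ceil_le.2 ?_
  have : (0 : ℝ) ≤ h := by positivity
  nlinarith

theorem le_dOf (δ : ℝ) (h : ℕ) : δ * h ≤ dOf δ h := Nat.le_ceil _

theorem NOf_le (δ : ℝ) (h : ℕ) : (NOf δ h : ℝ) ≤
    (dOf δ h : ℝ) ^ ((1 : ℝ) + (h : ℝ) / (2 * (dOf δ h : ℝ))) :=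
  Nat.floor_le (by positivity)

theorem NOf_le_rpow {δ : ℝ} (hδ : δ ∈ Set.Ioo (0 : ℝ) 1) {h : ℕ} (hh : 0 < h) :
    (NOf δ h : ℝ) ≤ (h : ℝ) ^ (1 + 1 / (2 * δ)) := by
  have hh' : (0 : ℝ) < h := by exact_mod_cast hh
  have hd0 : 0 < (dOf δ h : ℝ) := (mul_pos hδ.1 hh').trans_le (le_dOf δ h)
  have hd1 : (1 : ℝ) ≤ dOf δ h := by
    have : 0 < dOf δ h := by exact_mod_cast hd0
    exact_mod_cast this
  have hdh : (dOf δ h : ℝ) ≤ h := by exact_mod_cast dOf_le hδ.2.le h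
  refine (NOf_le δ h).trans ((Real.rpow_le_rpow_of_exponent_le hd1 (z := 1 + 1 / (2 * δ)) ?_).trans
    (Real.rpow_le_rpow hd0.le hdh ?_))
  · have hδ0 := hδ.1
    rw [add_le_add_iff_left, div_le_div_iff₀ (by positivity) (by positivity)]
    have := le_dOf δ h
    linarith
  · have hδ0 := hδ.1
    positivity

/-- For `k` of nearly linear size, the number of supports is at most about `h ^ ((1 - ε) h / 2)`. -/
theorem choose_NOf_le {ε δ γ : ℝ} (hδ : δ ∈ Set.Ioo (0 : ℝ) 1) (hγ : 0 ≤ γ) (hε : ε ≤ 1)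
    {h k : ℕ} (hh : 0 < h) (hkh : k ≤ h) (hk : (h : ℝ) ^ (1 - γ) ≤ k)
    (hkd : (k : ℝ) ≤ (1 - ε) * dOf δ h) :
    ((NOf δ h).choose k : ℝ) ≤ (Real.exp 1 * (h : ℝ) ^ (γ + (1 - ε) / 2)) ^ h := by
  have hh' : (0 : ℝ) < h := by exact_mod_cast hh
  have hh1 : (1 : ℝ) ≤ h := by exact_mod_cast hh
  have hk0' : (0 : ℝ) < k := (Real.rpow_pos_of_pos hh' _).trans_le hk
  have hk0 : 0 < k := by exact_mod_cast hk0'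
  set d : ℝ := ((dOf δ h : ℕ) : ℝ) with hd
  have hd0 : 0 < d := (mul_pos hδ.1 hh').trans_le (le_dOf δ h)
  have hd1 : (1 : ℝ) ≤ d := by
    rw [hd] at hd0 ⊢
    exact Nat.one_le_cast.2 (Nat.cast_pos.1 hd0)
  have hdh : d ≤ h := by rw [hd]; exact_mod_cast dOf_le hδ.2.le h
  have hNk : (NOf δ h : ℝ) / k ≤ (h : ℝ) ^ γ * d ^ (h / (2 * d)) := by
    rw [div_le_iff₀ hk0']
    refine (NOf_le δ h).trans ?_
    rw [Real.rpow_add hd0, Real.rpow_one]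
    have h1 : (h : ℝ) = (h : ℝ) ^ γ * (h : ℝ) ^ (1 - γ) := by
      rw [← Real.rpow_add hh', add_sub_cancel, Real.rpow_one]
    have h2 : d ≤ (h : ℝ) ^ γ * k := by
      refine hdh.trans (h1.le.trans ?_)
      gcongr
    calc d * d ^ (h / (2 * d)) ≤ ((h : ℝ) ^ γ * k) * d ^ (h / (2 * d)) := by gcongr
      _ = _ := by ring
  have hpow : (d ^ (h / (2 * d))) ^ k ≤ ((h : ℝ) ^ ((1 - ε) / 2)) ^ h := by
    rw [← Real.rpow_mul_natCast hd0.le, ← Real.rpow_mul_natCast hh'.le]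
    refine (Real.rpow_le_rpow_of_exponent_le hd1 (z := (1 - ε) / 2 * h) ?_).trans
      (Real.rpow_le_rpow hd0.le hdh ?_)
    · rw [div_mul_eq_mul_div, div_le_iff₀ (by positivity)]
      nlinarith
    · have : 0 ≤ 1 - ε := by linarith
      positivity
  have hbase : 1 ≤ Real.exp 1 * (h : ℝ) ^ γ := by
    have h1 : (1 : ℝ) ≤ Real.exp 1 := Real.one_le_exp (by norm_num)
    have h2 := Real.one_le_rpow hh1 hγ
    nlinarith
  calc ((NOf δ h).choose k : ℝ) ≤ (Real.exp 1 * (NOf δ h / k)) ^ k :=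
        choose_le_exp_mul_div_pow _ _ hk0
    _ ≤ (Real.exp 1 * ((h : ℝ) ^ γ * d ^ (h / (2 * d)))) ^ k := by gcongr
    _ = (Real.exp 1 * (h : ℝ) ^ γ) ^ k * (d ^ (h / (2 * d))) ^ k := by rw [← mul_pow, mul_assoc]
    _ ≤ (Real.exp 1 * (h : ℝ) ^ γ) ^ h * ((h : ℝ) ^ ((1 - ε) / 2)) ^ h := by
        gcongr
    _ = _ := by rw [← mul_pow, Real.rpow_add hh', mul_assoc]

theorem choose_NOf_mul_small_cost_le {ε δ : ℝ} (hδ : δ ∈ Set.Ioo (0 : ℝ) 1) {A h k p : ℕ}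
    (hh3 : (3 : ℝ) ≤ h) (hpu' : (p : ℝ) ≤ 2 * (h : ℝ) ^ A)
    (hlog : 4 * (2 + (A + (1 + 1 / (2 * δ)))) * Real.log h ≤ (h : ℝ) ^ (ε / 8))
    (hk : (k : ℝ) ≤ (h : ℝ) ^ (1 - ε / 8)) :
    ((NOf δ h).choose k : ℝ) * ((2 * p : ℝ) ^ k / 2 ^ h) ≤ 2 * Real.exp (-(h / 4)) := by
  have hh1 : (1 : ℝ) ≤ h := by linarith
  have hh0 : (0 : ℝ) < h := by linarith
  have hh : 0 < h := by exact_mod_cast hh0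
  have hδ0 := hδ.1
  set c : ℝ := A + (1 + 1 / (2 * δ)) with hc
  have hN := NOf_le_rpow hδ hh
  have hbase : (2 * p : ℝ) * NOf δ h ≤ Real.exp ((h : ℝ) ^ (ε / 8) / 4) := by
    have h1 : (2 * p : ℝ) * NOf δ h ≤ (h : ℝ) ^ (2 + c) := by
      calc (2 * p : ℝ) * NOf δ h ≤ (2 * (2 * (h : ℝ) ^ A)) * (h : ℝ) ^ (1 + 1 / (2 * δ)) := by
            gcongr
        _ = 4 * (h : ℝ) ^ c := by
            rw [hc, Real.rpow_add hh0 (A : ℝ) (1 + 1 / (2 * δ)), Real.rpow_natCast]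
            ring
        _ ≤ (h : ℝ) ^ (2 : ℝ) * (h : ℝ) ^ c := by
            gcongr
            norm_num
            nlinarith
        _ = _ := by rw [← Real.rpow_add hh0]
    refine h1.trans ?_
    rw [Real.rpow_def_of_pos hh0, Real.exp_le_exp]
    have : 0 ≤ 73 * ((A : ℝ) + 1) * Real.log h := by positivity
    linarith
  have h2h : Real.exp (1 / 2) ^ h ≤ 2 ^ h := by
    refine pow_le_pow_left₀ (Real.exp_pos _).le ?_ h
    refine le_of_sq_le_sq ?_ (by norm_num)
    rw [← Real.exp_nat_mul]
    norm_num
    exact Real.exp_one_lt_d9.le.trans (by norm_num)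
  have hnum : ((NOf δ h).choose k : ℝ) * (2 * p : ℝ) ^ k ≤ Real.exp (h / 4) := by
    calc ((NOf δ h).choose k : ℝ) * (2 * p : ℝ) ^ k ≤ (NOf δ h : ℝ) ^ k * (2 * p) ^ k := by
          gcongr
          exact_mod_cast Nat.choose_le_pow _ _
      _ = (2 * p * NOf δ h) ^ k := by rw [← mul_pow, mul_comm]
      _ ≤ Real.exp ((h : ℝ) ^ (ε / 8) / 4) ^ k := by gcongr
      _ = Real.exp (k * ((h : ℝ) ^ (ε / 8) / 4)) := by rw [Real.exp_nat_mul]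
      _ ≤ Real.exp (h / 4) := by
          rw [Real.exp_le_exp]
          have h1 : (k : ℝ) ≤ (h : ℝ) ^ (1 - ε / 8) := hk
          have h2 : (h : ℝ) ^ (1 - ε / 8) * (h : ℝ) ^ (ε / 8) = h := by
            rw [← Real.rpow_add hh0, sub_add_cancel, Real.rpow_one]
          have h3 := mul_le_mul_of_nonneg_right h1
            (Real.rpow_nonneg hh0.le (ε / 8))
          linarith
  rw [mul_div_assoc', div_le_iff₀ (by positivity)]
  refine hnum.trans ?_
  have h5 : Real.exp (h / 4) = Real.exp (-(h / 4)) * Real.exp (1 / 2) ^ h := by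
    rw [← Real.exp_nat_mul, ← Real.exp_add]
    ring_nf
  rw [h5]
  have h6 := Real.exp_pos (-((h : ℝ) / 4))
  have h7 := mul_le_mul_of_nonneg_left h2h h6.le
  have h8 : 0 ≤ Real.exp (-((h : ℝ) / 4)) * 2 ^ h := by positivity
  linarith

theorem choose_NOf_mul_large_cost_le {ε δ : ℝ} (hε : ε ∈ Set.Ioo (0 : ℝ) 1)
    (hδ : δ ∈ Set.Ioo (0 : ℝ) 1) {A h k m p q : ℕ} (hA : 4 ≤ A * ε) (hh : 0 < h)
    (hpl' : (h : ℝ) ^ A ≤ p) (hq0 : (0 : ℝ) < q) (hql : (h : ℝ) ^ (1 / 2 - ε / 8) ≤ 2 * q)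
    (hLb : (p : ℝ) ^ m ≤ Real.exp 1 ^ h) (hconst : 128 * Real.exp 3 ≤ (h : ℝ) ^ (ε / 4))
    (hkh : k ≤ h) (hkl : (h : ℝ) ^ (1 - ε / 8) ≤ k) (hkx : (k : ℝ) ≤ (1 - ε) * dOf δ h) :
    ((NOf δ h).choose k : ℝ) * ((p : ℝ) ^ m * 4 ^ h *
      (2 ^ h * (p : ℝ) ^ k / (p : ℝ) ^ h + (16 / q) ^ h)) ≤ 2 * Real.exp (-(h / 4)) := by
  obtain ⟨hε0, hε1⟩ := hε
  have hh0 : (0 : ℝ) < h := by exact_mod_cast hh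
  have hh1 : (1 : ℝ) ≤ h := by exact_mod_cast hh
  have hdh : (dOf δ h : ℝ) ≤ h := by exact_mod_cast dOf_le hδ.2.le h
  have hkε : (k : ℝ) ≤ (1 - ε) * h :=
    hkx.trans (mul_le_mul_of_nonneg_left hdh (by linarith))
  have hp0 : (0 : ℝ) < p := (pow_pos hh0 A).trans_le hpl'
  have hch := choose_NOf_le hδ (γ := ε / 8) (by linarith) hε1.le hh hkh hkl hkx
  have hqpow : (16 / q : ℝ) ^ h ≤ (32 * (h : ℝ) ^ (ε / 8 - 1 / 2)) ^ h := by
    refine pow_le_pow_left₀ (by positivity) ?_ h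
    have h1 : (h : ℝ) ^ (ε / 8 - 1 / 2) = ((h : ℝ) ^ (1 / 2 - ε / 8))⁻¹ := by
      rw [← Real.rpow_neg hh0.le]
      ring_nf
    rw [h1, ← div_eq_mul_inv, div_le_div_iff₀ hq0 (by positivity)]
    linarith
  have hppow : (2 : ℝ) ^ h * (p : ℝ) ^ k / (p : ℝ) ^ h ≤
      (32 * (h : ℝ) ^ (ε / 8 - 1 / 2)) ^ h := by
    have h1 : (h : ℝ) ^ h * (p : ℝ) ^ k ≤ (p : ℝ) ^ h := by
      have h2 : h ≤ A * (h - k) := by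
        have h3 : (h : ℝ) ≤ A * ((h - k : ℕ) : ℝ) := by
          rw [Nat.cast_sub hkh]
          have h4 : ε * h ≤ h - k := by linarith
          have h5 : (A : ℝ) * (ε * h) ≤ A * (h - k) := by gcongr
          nlinarith
        exact_mod_cast h3
      calc (h : ℝ) ^ h * (p : ℝ) ^ k ≤ (h : ℝ) ^ (A * (h - k)) * (p : ℝ) ^ k := by
            gcongr
        _ = ((h : ℝ) ^ A) ^ (h - k) * (p : ℝ) ^ k := by rw [pow_mul]
        _ ≤ (p : ℝ) ^ (h - k) * (p : ℝ) ^ k := by gcongr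
        _ = _ := by rw [← pow_add, Nat.sub_add_cancel hkh]
    have h2 : (2 : ℝ) ^ h * (p : ℝ) ^ k / (p : ℝ) ^ h ≤ (2 / h) ^ h := by
      rw [div_pow, div_le_div_iff₀ (by positivity) (by positivity)]
      have := mul_le_mul_of_nonneg_left h1 (show (0 : ℝ) ≤ 2 ^ h by positivity)
      linarith
    refine h2.trans (pow_le_pow_left₀ (by positivity) ?_ h)
    have h3 : (h : ℝ) ^ (-1 : ℝ) ≤ (h : ℝ) ^ (ε / 8 - 1 / 2) :=
      Real.rpow_le_rpow_of_exponent_le hh1 (by linarith)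
    rw [Real.rpow_neg_one] at h3
    have h4 : (0 : ℝ) ≤ (h : ℝ)⁻¹ := by positivity
    rw [div_eq_mul_inv]
    linarith
  have hbase : Real.exp 1 * (h : ℝ) ^ (ε / 8 + (1 - ε) / 2) *
      (Real.exp 1 * 4 * (32 * (h : ℝ) ^ (ε / 8 - 1 / 2))) ≤ Real.exp (-1) := by
    have h1 : (h : ℝ) ^ (ε / 8 + (1 - ε) / 2) * (h : ℝ) ^ (ε / 8 - 1 / 2) =
        ((h : ℝ) ^ (ε / 4))⁻¹ := by
      rw [← Real.rpow_add hh0, ← Real.rpow_neg hh0.le]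
      ring_nf
    have h2 : Real.exp 3 = Real.exp 1 * Real.exp 1 * Real.exp 1 := by
      rw [← Real.exp_add, ← Real.exp_add]
      norm_num
    calc _ = 128 * (Real.exp 1 * Real.exp 1) *
          ((h : ℝ) ^ (ε / 8 + (1 - ε) / 2) * (h : ℝ) ^ (ε / 8 - 1 / 2)) := by ring
      _ ≤ _ := by
        rw [h1, Real.exp_neg, ← div_eq_mul_inv, div_le_iff₀ (by positivity),
          ← div_eq_inv_mul, le_div_iff₀ (Real.exp_pos _)]
        linarith
  calc _ ≤ (Real.exp 1 * (h : ℝ) ^ (ε / 8 + (1 - ε) / 2)) ^ h * (Real.exp 1 ^ h * 4 ^ h *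
        ((32 * (h : ℝ) ^ (ε / 8 - 1 / 2)) ^ h + (32 * (h : ℝ) ^ (ε / 8 - 1 / 2)) ^ h)) := by
          gcongr
    _ = 2 * (Real.exp 1 * (h : ℝ) ^ (ε / 8 + (1 - ε) / 2) *
      (Real.exp 1 * 4 * (32 * (h : ℝ) ^ (ε / 8 - 1 / 2)))) ^ h := by
          simp only [mul_pow]
          ring
    _ ≤ 2 * Real.exp (-1) ^ h := by gcongr
    _ ≤ 2 * Real.exp (-(h / 4)) := by
          rw [← Real.exp_nat_mul]
          gcongr
          linarith

set_option maxHeartbeats 1000000 in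
/-- Quantitative form of the theorem for a single large `h`. -/
theorem one_sub_le_prob_of_large {ε δ : ℝ} (hε : ε ∈ Set.Ioo (0 : ℝ) 1)
    (hδ : δ ∈ Set.Ioo (0 : ℝ) 1) {A h : ℕ} (hA : 4 ≤ A * ε) (hh : 3 ≤ h)
    (hlog : (73 * (A + 1) + 4 * (2 + (A + (1 + 1 / (2 * δ))))) * Real.log h ≤
      (h : ℝ) ^ (ε / 12))
    (hconst : 128 * Real.exp 3 ≤ (h : ℝ) ^ (ε / 4)) :
    1 - h * (2 * Real.exp (-(h / 4))) ≤ prob (fun s : Fin h → Fin (NOf δ h) → Bool =>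
        ∀ u : Fin (NOf δ h) → ℝ, u ≠ 0 →
          (hw u : ℝ) ≤ (1 - ε) * (dOf δ h : ℝ) → (signMat s).mulVec u ≠ 0) := by
  obtain ⟨hε0, hε1⟩ := hε
  have hδ0 := hδ.1
  have hh3 : (3 : ℝ) ≤ h := by exact_mod_cast hh
  have hh0 : (0 : ℝ) < h := by linarith
  have hh1 : (1 : ℝ) ≤ h := by linarith
  have hlh : 1 ≤ Real.log h := by
    rw [Real.le_log_iff_exp_le hh0]
    exact (Real.exp_one_lt_d9.le.trans (by norm_num)).trans hh3
  have hA1 : 1 ≤ A := by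
    rcases Nat.eq_zero_or_pos A with rfl | hpos
    · norm_num at hA
    · exact hpos
  obtain ⟨p, hp, hpl, hpu⟩ := Nat.exists_prime_lt_and_le_two_mul (h ^ A) (by positivity)
  have : Fact p.Prime := ⟨hp⟩
  have hhA : h ≤ h ^ A := Nat.le_self_pow (by omega) h
  have hp0 : (0 : ℝ) < p := by exact_mod_cast hp.pos
  have hpl' : (h : ℝ) ^ A ≤ p := by exact_mod_cast hpl.le
  have hpu' : (p : ℝ) ≤ 2 * (h : ℝ) ^ A := by exact_mod_cast hpu
  set l := Real.log p with hl
  have hl1 : 1 ≤ l := by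
    refine hlh.trans (Real.log_le_log hh0 ?_)
    exact_mod_cast hhA.trans hpl.le
  have hlu : l ≤ (A + 1) * Real.log h := by
    have h1 : l ≤ Real.log (h * (h : ℝ) ^ A) :=
      Real.log_le_log hp0 (hpu'.trans (by gcongr; linarith))
    rw [Real.log_mul (by positivity) (by positivity), Real.log_pow] at h1
    linarith
  set c : ℝ := A + (1 + 1 / (2 * δ)) with hc
  have hc0 : 0 ≤ c := by positivity
  have hl73 : 73 * l ≤ (h : ℝ) ^ (ε / 12) := by
    refine le_trans ?_ hlog
    have : 0 ≤ 4 * (2 + c) * Real.log h := by positivity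
    linarith
  have hl3 : 73 * l ^ 3 ≤ (h : ℝ) ^ (ε / 4) := by
    have h1 : (73 * l) ^ 3 ≤ ((h : ℝ) ^ (ε / 12)) ^ 3 := pow_le_pow_left₀ (by positivity) hl73 3
    rw [← Real.rpow_mul_natCast hh0.le] at h1
    have h2 : ε / 12 * (3 : ℕ) = ε / 4 := by push_cast; ring
    rw [h2] at h1
    have h3 : 0 ≤ l ^ 3 := by positivity
    linarith [mul_pow 73 l 3]
  have hmono : (h : ℝ) ^ (ε / 12) ≤ (h : ℝ) ^ (ε / 8) :=
    Real.rpow_le_rpow_of_exponent_le hh1 (by linarith)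
  set r := Real.sqrt (8 * l) with hr
  have hr2 : r ^ 2 = 8 * l := Real.sq_sqrt (by positivity)
  set L := ⌈6 * l⌉₊ + 1 with hLdef
  have hLu : (L : ℝ) ≤ 8 * l := by
    have := (Nat.ceil_lt_add_one (a := 6 * l) (by positivity)).le
    rw [hLdef]
    push_cast
    linarith
  have hLl : 6 * l < L := by
    have := Nat.le_ceil (6 * l)
    rw [hLdef]
    push_cast
    linarith
  set q := ⌊(h : ℝ) ^ (1 / 2 - ε / 8)⌋₊ with hq
  have hq1' : 1 ≤ (h : ℝ) ^ (1 / 2 - ε / 8) := Real.one_le_rpow hh1 (by linarith)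
  have hq1 : 1 ≤ q := Nat.le_floor (by exact_mod_cast hq1')
  have hqu : (q : ℝ) ≤ (h : ℝ) ^ (1 / 2 - ε / 8) := Nat.floor_le (by positivity)
  have hql : (h : ℝ) ^ (1 / 2 - ε / 8) ≤ 2 * q := by
    have h1 := (Nat.lt_floor_add_one ((h : ℝ) ^ (1 / 2 - ε / 8))).le
    have h2 : (1 : ℝ) ≤ q := by exact_mod_cast hq1
    rw [← hq] at h1
    linarith
  have hqr : (q * r) ^ 2 ≤ 8 * l * (h : ℝ) ^ (1 - ε / 4) := by
    rw [mul_pow, hr2]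
    have h1 : (q : ℝ) ^ 2 ≤ ((h : ℝ) ^ (1 / 2 - ε / 8)) ^ 2 := by gcongr
    rw [← Real.rpow_mul_natCast hh0.le] at h1
    have h2 : (1 / 2 - ε / 8) * (2 : ℕ) = 1 - ε / 4 := by push_cast; ring
    rw [h2] at h1
    nlinarith
  set k₀ := ⌊(h : ℝ) ^ (1 - ε / 8)⌋₊ with hk₀def
  have hk₀u : (k₀ : ℝ) ≤ (h : ℝ) ^ (1 - ε / 8) := Nat.floor_le (by positivity)
  have hk₀ : (q * r) ^ 2 ≤ 2 * k₀ := by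
    have h1 : (h : ℝ) ^ (1 - ε / 8) = (h : ℝ) ^ (ε / 8) * (h : ℝ) ^ (1 - ε / 4) := by
      rw [← Real.rpow_add hh0]
      ring_nf
    have h2 : 8 * l * (h : ℝ) ^ (1 - ε / 4) ≤ (h : ℝ) ^ (1 - ε / 8) := by
      rw [h1]
      gcongr
      linarith
    have h3 := (Nat.lt_floor_add_one ((h : ℝ) ^ (1 - ε / 8))).le
    rw [← hk₀def] at h3
    have h4 : 1 ≤ (h : ℝ) ^ (1 - ε / 8) := Real.one_le_rpow hh1 (by linarith)
    have h5 : (1 : ℝ) ≤ k₀ := by exact_mod_cast Nat.le_floor (by exact_mod_cast h4)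
    linarith
  set b := ⌈(L : ℝ) * (q * r) ^ 2⌉₊ with hb
  have hLb : (p : ℝ) ^ (L + b) ≤ Real.exp 1 ^ h := by
    have h1 : (b : ℝ) ≤ L * (q * r) ^ 2 + 1 := (Nat.ceil_lt_add_one (by positivity)).le
    have h2 : (L : ℝ) * (q * r) ^ 2 ≤ 8 * l * (8 * l * (h : ℝ) ^ (1 - ε / 4)) := by gcongr
    have h3 : 1 ≤ (h : ℝ) ^ (1 - ε / 4) := Real.one_le_rpow hh1 (by linarith)
    have h4 : (L + b : ℝ) ≤ 73 * l ^ 2 * (h : ℝ) ^ (1 - ε / 4) := by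
      have h6 : 9 * l ≤ 9 * l ^ 2 * (h : ℝ) ^ (1 - ε / 4) := by
        calc 9 * l ≤ 9 * l ^ 2 := by nlinarith
          _ ≤ _ := le_mul_of_one_le_right (by positivity) h3
      linarith
    have h5 : (L + b : ℝ) * l ≤ h := by
      calc (L + b : ℝ) * l ≤ 73 * l ^ 2 * (h : ℝ) ^ (1 - ε / 4) * l := by gcongr
        _ = 73 * l ^ 3 * (h : ℝ) ^ (1 - ε / 4) := by ring
        _ ≤ (h : ℝ) ^ (ε / 4) * (h : ℝ) ^ (1 - ε / 4) := by gcongr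
        _ = h := by rw [← Real.rpow_add hh0, add_sub_cancel, Real.rpow_one]
    rw [← Real.exp_log hp0, ← Real.exp_nat_mul, ← Real.exp_nat_mul, Real.exp_le_exp]
    push_cast
    linarith
  have hL : 5 ^ L * p < 6 ^ L := by
    have h1 : (p : ℝ) < Real.exp (1 / 6) ^ L := by
      rw [← Real.exp_log hp0, ← Real.exp_nat_mul, Real.exp_lt_exp]
      linarith
    have h2 : Real.exp (1 / 6) ≤ 6 / 5 := by
      have := Real.one_sub_le_exp_neg (1 / 6)
      rw [Real.exp_neg, le_inv_comm₀ (by norm_num) (Real.exp_pos _)] at this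
      norm_num at this ⊢
      exact this
    have h3 : (p : ℝ) < (6 / 5) ^ L := h1.trans_le (pow_le_pow_left₀ (Real.exp_pos _).le h2 L)
    rw [div_pow, lt_div_iff₀ (by positivity)] at h3
    rw [mul_comm]
    exact_mod_cast h3
  set x := (1 - ε) * (dOf δ h : ℝ) with hx
  have hx0 : 0 ≤ x := mul_nonneg (by linarith) (by positivity)
  have hdh : (dOf δ h : ℝ) ≤ h := by exact_mod_cast dOf_le hδ.2.le h
  have hxh : x ≤ (1 - ε) * h := mul_le_mul_of_nonneg_left hdh (by linarith)
  have hKx : (⌊x⌋₊ : ℝ) ≤ x := Nat.floor_le hx0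
  have hKh : ⌊x⌋₊ ≤ h := by
    have : (⌊x⌋₊ : ℝ) ≤ h := by nlinarith
    exact_mod_cast this
  have hmain := one_sub_le_prob_no_sparse_kernel (h := h) (N := NOf δ h) (K := ⌊x⌋₊) (p := p)
    (by omega) (q := q) (L := L) (b := b) (k₀ := k₀) hq1 (r := r) (x := x)
    (E := 2 * Real.exp (-(h / 4))) (Real.sqrt_nonneg _) hr2.ge hk₀ hL (Nat.le_ceil _) hKh
    (Nat.lt_floor_add_one x) ?_
  · refine le_trans ?_ hmain
    have : (⌊x⌋₊ : ℝ) ≤ h := by exact_mod_cast hKh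
    gcongr
  · intro k hk1 hkK
    have hkh : k ≤ h := hkK.trans hKh
    have hkx : (k : ℝ) ≤ x := le_trans (by exact_mod_cast hkK) hKx
    rw [supportCost]
    split_ifs with hk
    · have hk' : (k : ℝ) ≤ (h : ℝ) ^ (1 - ε / 8) := (Nat.cast_le.2 hk).trans hk₀u
      refine choose_NOf_mul_small_cost_le hδ hh3 hpu' (le_trans ?_ (hlog.trans hmono)) hk'
      have : 0 ≤ 73 * ((A : ℝ) + 1) * Real.log h := by positivity
      linarith
    · have hkl : (h : ℝ) ^ (1 - ε / 8) ≤ k := by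
        have h1 := (Nat.lt_floor_add_one ((h : ℝ) ^ (1 - ε / 8))).le
        rw [← hk₀def, ← Nat.cast_succ] at h1
        exact h1.trans (Nat.cast_le.2 (Nat.succ_le_of_lt (not_le.1 hk)))
      exact choose_NOf_mul_large_cost_le ⟨hε0, hε1⟩ hδ hA (by omega) hpl'
        (Nat.cast_pos.2 hq1) hql hLb hconst hkh hkl hkx

end Asymptotics

theorem stmt17 (ε δ : ℝ) (hε : ε ∈ Set.Ioo (0 : ℝ) 1) (hδ : δ ∈ Set.Ioo (0 : ℝ) 1) :
    Filter.Tendsto (fun h : ℕ =>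
      prob (fun s : Fin h → Fin (NOf δ h) → Bool =>
        ∀ u : Fin (NOf δ h) → ℝ, u ≠ 0 →
          (hw u : ℝ) ≤ (1 - ε) * (dOf δ h : ℝ) → (signMat s).mulVec u ≠ 0))
      Filter.atTop (nhds 1) := by
  have hε0 := hε.1
  have hδ0 := hδ.1
  obtain ⟨A, hA⟩ := exists_nat_ge (4 / ε)
  rw [div_le_iff₀ hε0] at hA
  have hlim : Filter.Tendsto (fun h : ℕ => 1 - (h : ℝ) * (2 * Real.exp (-(h / 4))))
      Filter.atTop (nhds 1) := by
    have h1 := (Real.tendsto_pow_mul_exp_neg_atTop_nhds_zero 1).comp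
      ((tendsto_natCast_atTop_atTop (R := ℝ)).atTop_div_const (show (0 : ℝ) < 4 by norm_num))
    have h2 := (h1.const_mul 8).const_sub 1
    rw [mul_zero, sub_zero] at h2
    refine h2.congr fun h => ?_
    simp only [Function.comp_apply, pow_one]
    ring
  refine tendsto_of_tendsto_of_tendsto_of_le_of_le' hlim tendsto_const_nhds ?_
    (Filter.Eventually.of_forall fun h => prob_le_one _)
  set C : ℝ := 73 * (A + 1) + 4 * (2 + (A + (1 + 1 / (2 * δ)))) with hC
  have hC0 : 0 < C := by positivity
  have hlog : ∀ᶠ h : ℕ in Filter.atTop, C * Real.log h ≤ (h : ℝ) ^ (ε / 12) := by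
    have h1 := (isLittleO_log_rpow_atTop (show 0 < ε / 12 by positivity)).bound (inv_pos.2 hC0)
    have h2 := tendsto_natCast_atTop_atTop (R := ℝ) |>.eventually h1
    filter_upwards [h2] with h hh
    rw [Real.norm_eq_abs, Real.norm_of_nonneg (by positivity), ← div_eq_inv_mul,
      le_div_iff₀ hC0] at hh
    have := mul_le_mul_of_nonneg_right (le_abs_self (Real.log h)) hC0.le
    linarith
  have hconst : ∀ᶠ h : ℕ in Filter.atTop, 128 * Real.exp 3 ≤ (h : ℝ) ^ (ε / 4) :=
    ((tendsto_rpow_atTop (show 0 < ε / 4 by positivity)).comp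
      tendsto_natCast_atTop_atTop).eventually_ge_atTop _
  filter_upwards [hlog, hconst, Filter.eventually_ge_atTop 3] with h h1 h2 h3
  exact one_sub_le_prob_of_large hε hδ hA h3 h1 h2
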